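/- arXiv:math/0304362 — 2 statements merged into one kernel-verified Lean document; each statement's English description precedes it below -/
import Mathlib

section
/- Let R be a Boolean ring and d, b ∈ R[x] with d - d^2·x = b^2. Then d = 0 and b = 0. -/
open Polynomial

/-- Let `R` be a Boolean ring and `d, b ∈ R[x]` with `d - d^2·x = b^2`.
Then `d = 0` and `b = 0`. -/
theorem stmt_6 (R : Type*) [CommRing R] (hB : ∀ r : R, r ^ 2 = r)
    (d b : R[X]) (h : d - d ^ 2 * X = b ^ 2) :
    d = 0 ∧ b = 0 := by
  have h2 : (2 : R) = 0 := by linear_combination hB 2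
  have hodd : ∀ n : ℕ, (b ^ 2).coeff (2 * n + 1) = 0 := by
    intro n
    have hd : derivative (b ^ 2) = 0 := by
      have : (2 : R[X]) = 0 := by
        have := congrArg (C : R → R[X]) h2
        rwa [C_0, map_ofNat C 2] at this
      rw [pow_two, derivative_mul]
      linear_combination (derivative b * b) * this
    have hc := congrArg (fun p => coeff p (2 * n)) hd
    simp only [coeff_derivative, coeff_zero] at hc
    push_cast at hc
    linear_combination hc - (b ^ 2).coeff (2 * n + 1) * n * h2
  have hsq : ∀ p : R[X], (p ^ 2).coeff (2 * p.natDegree) = p.leadingCoeff := by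
    intro p
    rw [pow_two, two_mul, coeff_mul_degree_add_degree, ← pow_two, hB]
  have hd : d = 0 := by
    have hc := congrArg (fun p => coeff p (2 * d.natDegree + 1)) h
    simp only [coeff_sub, coeff_mul_X, hodd, hsq] at hc
    rw [coeff_eq_zero_of_natDegree_lt (by omega)] at hc
    rw [← leadingCoeff_eq_zero]
    linear_combination -hc
  refine ⟨hd, ?_⟩
  have hb := hsq b
  rw [← h, hd] at hb
  rw [← leadingCoeff_eq_zero, ← hb]
  simp
end

section
/- Let (K, φ) be a nonsingular symmetric bilinear form over Z (K a finitely generated free abelian group, φ: K × K → Z symmetric with determinant ±1), and let v ∈ K be a characteristic element, i.e. φ(u, u) ≡ φ(u, v) (mod 2) for all u ∈ K. Then signature(K, φ) ≡ φ(v, v) (mod 8). -/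
open Matrix

open Complex Filter Topology HurwitzZeta in
theorem vdb_theta_bound (x : ℝ) (τ : ℂ) (hτ : 0 < τ.im) :
    ‖jacobiTheta₂ x τ - 1‖ ≤ cosKernel (0 : ℝ) τ.im - 1 := by
  have h1 := hasSum_jacobiTheta₂_term (x : ℂ) hτ
  have h2 := hasSum_ite_sub_hasSum h1 0
  have h3 := hasSum_int_cosKernel₀ 0 hτ
  have h4 : HasSum (fun n : ℤ => if n = 0 then 0 else Real.exp (-Real.pi * n ^ 2 * τ.im))
      (cosKernel (0:ℝ) τ.im - 1) := by
    rw [← hasSum_ofReal]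
    push_cast
    convert h3 using 1
    · ext n
      split_ifs <;> simp
    · rfl
  have h5 : jacobiTheta₂ x τ - jacobiTheta₂_term 0 x τ = jacobiTheta₂ x τ - 1 := by
    simp [jacobiTheta₂_term]
  rw [h5] at h2
  rw [← h2.tsum_eq]
  refine tsum_of_norm_bounded h4 fun n => ?_
  split_ifs with h
  · simp
  · rw [norm_jacobiTheta₂_term]; simp

open Complex Filter Topology HurwitzZeta in
theorem vdb_cos_lim (x : UnitAddCircle) : Tendsto (fun t : ℝ => cosKernel x t) atTop (𝓝 1) := by
  obtain ⟨p, hp, h⟩ := isBigO_atTop_cosKernel_sub x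
  have : Tendsto (fun t : ℝ => Real.exp (-p * t)) atTop (𝓝 0) := by
    refine Real.tendsto_exp_atBot.comp ?_
    exact tendsto_id.const_mul_atTop_of_neg (by linarith)
  have := (h.trans_tendsto this).add_const 1
  simpa using this

open Complex Filter Topology HurwitzZeta in
theorem vdb_split (g : ℤ → ℂ) (N : ℕ) [NeZero N] (hg : ∀ k m : ℤ, g (k + N * m) = g k) (t : ℝ) (ht : 0 < t)
    (T : ℂ) (hT : HasSum (fun n : ℤ => g n * Real.exp (-Real.pi * n ^ 2 * t)) T) :
    T = ∑ k : Fin N, g (k : ℕ) * (evenKernel (((k : ℕ) : ℝ) / N : ℝ) (N ^ 2 * t) : ℝ) := by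
  have hN : (N : ℝ) ≠ 0 := by exact_mod_cast NeZero.ne N
  have h1 := ((Equiv.prodComm _ _).trans (Int.divModEquiv N).symm).hasSum_iff.mpr hT
  refine (h1.prod_fiberwise (g := fun k : Fin N =>
    g (k : ℕ) * (evenKernel (((k : ℕ) : ℝ) / N : ℝ) (N ^ 2 * t) : ℝ)) ?_).unique
      (hasSum_fintype _)
  intro k
  have h2 := hasSum_int_evenKernel (((k : ℕ) : ℝ) / N) (t := N ^ 2 * t) (by positivity)
  have h3 := (hasSum_ofReal.mpr h2).mul_left (g (k : ℕ))
  refine cast (congrArg (fun f : ℤ → ℂ => HasSum f _) (funext fun m => Eq.symm ?_)) h3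
  simp only [Function.comp, Equiv.trans_apply, Equiv.prodComm_apply, Prod.swap_prod_mk, Int.divModEquiv_symm_apply]
  rw [show m * (N:ℤ) + ((k:ℕ):ℤ) = (k:ℕ) + N * m by ring, hg]
  congr 3
  push_cast
  field_simp
  ring

open Complex Filter Topology HurwitzZeta in
theorem vdb_avg (g : ℤ → ℂ) (N : ℕ) [NeZero N] (hg : ∀ k m : ℤ, g (k + N * m) = g k)
    (T : ℝ → ℂ) (hT : ∀ t > 0, HasSum (fun n : ℤ => g n * Real.exp (-Real.pi * n ^ 2 * t)) (T t)) :
    Tendsto (fun t : ℝ => (Real.sqrt t : ℂ) * T t) (𝓝[>] 0) (𝓝 ((∑ k : Fin N, g (k : ℕ)) / N)) := by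
  have hN : (0:ℝ) < N := by exact_mod_cast Nat.pos_of_ne_zero (NeZero.ne N)
  have key : ∀ t > 0, (Real.sqrt t : ℂ) * T t = 
     ∑ k : Fin N, g (k : ℕ) * ((1 / N * cosKernel (((k : ℕ) : ℝ) / N : ℝ) (1 / (N ^ 2 * t)) : ℝ) : ℂ) := by
    intro t ht
    rw [vdb_split g N hg t ht _ (hT t ht), Finset.mul_sum]
    refine Finset.sum_congr rfl fun k _ => ?_
    rw [mul_left_comm, ← ofReal_mul, evenKernel_functional_equation, ← Real.sqrt_eq_rpow,
      Real.sqrt_mul (by positivity), Real.sqrt_sq hN.le]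
    congr 2
    have : Real.sqrt t ≠ 0 := (Real.sqrt_pos.mpr ht).ne'
    field_simp
  have hlim : Tendsto (fun t : ℝ => 1 / ((N:ℝ) ^ 2 * t)) (𝓝[>] 0) atTop := by
    simp only [one_div, mul_inv]
    exact tendsto_inv_nhdsGT_zero.const_mul_atTop (by positivity)
  have h : Tendsto (fun t : ℝ => ∑ k : Fin N, g (k : ℕ) * ((1 / N * cosKernel (((k : ℕ) : ℝ) / N : ℝ) (1 / (N ^ 2 * t)) : ℝ) : ℂ)) (𝓝[>] 0) (𝓝 (∑ k : Fin N, g (k : ℕ) * ((1 / N * 1 : ℝ) : ℂ))) := by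
    refine tendsto_finsetSum _ fun k _ => ?_
    refine Tendsto.const_mul _ ?_
    refine (continuous_ofReal.tendsto _).comp ?_
    exact ((vdb_cos_lim _).comp hlim).const_mul _
  rw [← Finset.sum_mul] at h
  have e : (∑ k : Fin N, g (k : ℕ)) / N = (∑ k : Fin N, g (k : ℕ)) * ((1 / N * 1 : ℝ) : ℂ) := by
    push_cast; ring
  rw [e]
  refine h.congr' ?_
  filter_upwards [self_mem_nhdsWithin] with t ht
  exact (key t ht).symm

open Complex in
theorem vdb_cpow (t : ℝ) (ht : 0 < t) (x : ℂ) (hx : x ≠ 0) :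
    ((t : ℂ) * x) ^ (1 / 2 : ℂ) = (Real.sqrt t : ℂ) * x ^ (1 / 2 : ℂ) := by
  have ht' : (t : ℂ) ≠ 0 := by exact_mod_cast ht.ne'
  rw [Real.sqrt_eq_rpow, ofReal_cpow ht.le, cpow_def_of_ne_zero (mul_ne_zero ht' hx),
    log_ofReal_mul ht hx, cpow_def_of_ne_zero ht', cpow_def_of_ne_zero hx, ← Complex.exp_add,
    ofReal_log ht.le]
  push_cast
  ring_nf

open Complex Filter Topology HurwitzZeta in
theorem vdb_theta_shift (a c : ℤ) (hc : (2:ℤ) ∣ c - a) (x w : ℂ) :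
    jacobiTheta₂ (c / 2 + x) (-a + w) = jacobiTheta₂ x w := by
  unfold jacobiTheta₂
  refine tsum_congr fun n => ?_
  unfold jacobiTheta₂_term
  obtain ⟨e, he⟩ := hc
  obtain ⟨f, hf⟩ := Int.even_or_odd' n
  have : ∃ q : ℤ, n * c - n ^ 2 * a = 2 * q := by
    have hc : c = a + 2 * e := by linarith
    rcases hf with hf | hf
    · exact ⟨f * c - 2 * f ^ 2 * a, by rw [hf]; ring⟩
    · exact ⟨n * e - n * f * a, by rw [hc]; linear_combination (-n * a) * hf⟩
  obtain ⟨q, hq⟩ := this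
  have hq' : (n * c - n ^ 2 * a : ℂ) = 2 * q := by exact_mod_cast hq
  rw [Complex.exp_eq_exp_iff_exists_int]
  refine ⟨q, ?_⟩
  linear_combination (Real.pi * I) * hq'

open Complex Filter Topology HurwitzZeta in
theorem vdb_theta_id (a c : ℤ) (ha : 0 < a) (hc : (2:ℤ) ∣ c - a) (t : ℝ) (ht : 0 < t) :
    jacobiTheta₂ (c / (2 * a)) (1 / a + I * t) =
      1 / (t + -I / a) ^ (1 / 2 : ℂ) * cexp (-Real.pi * I * (c ^ 2 / (4 * a)) / (1 + I * a * t)) *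
      (1 / (t * (a ^ 2 / (1 + I * a * t))) ^ (1 / 2 : ℂ) *
        cexp (Real.pi * c ^ 2 * t / (4 * (1 + I * a * t))) *
        jacobiTheta₂ ((-c / (2 * a) : ℝ) : ℂ) (I / (a ^ 2 * t) - 1 / a)) := by
  have ha' : (a : ℂ) ≠ 0 := by exact_mod_cast ha.ne'
  have ht' : (t : ℂ) ≠ 0 := by exact_mod_cast ht.ne'
  have h1 : (1 + I * a * t : ℂ) ≠ 0 := by
    intro h
    have := congrArg Complex.re h
    simp at this
  have hτ : (1 / a + I * t : ℂ) = (1 + I * a * t) / a := by field_simp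
  rw [jacobiTheta₂_functional_equation]
  congr 1
  · congr 2
    · congr 1
      linear_combination (-t : ℂ) * I_sq
    · rw [hτ]; field_simp; norm_num
  · have e1 : (-1 / (1 / a + I * t) : ℂ) = -a + I * (t * (a ^ 2 / (1 + I * a * t))) := by
      rw [hτ]; field_simp; ring
    have e2 : (c / (2 * a) / (1 / a + I * t) : ℂ) =
        c / 2 + (-(I * c * a * t / (2 * (1 + I * a * t)))) := by
      rw [hτ]
      have h2 : I * c * a * t = c * ((1 + I * a * t) - 1) := by ring
      rw [h2]
      generalize (1 + I * a * t : ℂ) = D at h1 ⊢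
      field_simp; ring
    rw [e1, e2, vdb_theta_shift a c hc, jacobiTheta₂_functional_equation]
    congr 1
    · congr 2
      · congr 1
        linear_combination (-(t * (a ^ 2 / (1 + I * a * t))) : ℂ) * I_sq
      · field_simp
        linear_combination (-4 * c ^ 2 : ℂ) * I_sq
    · congr 1
      · push_cast; field_simp
      · field_simp
        linear_combination (-1 : ℂ) * I_sq

open Complex Filter Topology HurwitzZeta in
theorem vdb_theta_lim (a c : ℤ) (ha : 0 < a) (hc : (2:ℤ) ∣ c - a) :
    Tendsto (fun t : ℝ => (Real.sqrt t : ℂ) * jacobiTheta₂ (c / (2 * a)) (1 / a + I * t)) (𝓝[>] 0)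
      (𝓝 (1 / (-I / a) ^ (1 / 2 : ℂ) * cexp (-Real.pi * I * (c ^ 2 / (4 * a))) *
        (1 / ((a:ℂ) ^ 2) ^ (1 / 2 : ℂ)))) := by
  have ha' : (a : ℂ) ≠ 0 := by exact_mod_cast ha.ne'
  have haR : (0 : ℝ) < a := by exact_mod_cast ha
  have hlim : Tendsto (fun t : ℝ => 1 / ((a:ℝ) ^ 2 * t)) (𝓝[>] 0) atTop := by
    simp only [one_div, mul_inv]
    exact tendsto_inv_nhdsGT_zero.const_mul_atTop (by positivity)
  have hU : Tendsto (fun t : ℝ => jacobiTheta₂ ((-c / (2 * a) : ℝ) : ℂ) (I / (a ^ 2 * t) - 1 / a))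
      (𝓝[>] 0) (𝓝 1) := by
    rw [tendsto_iff_norm_sub_tendsto_zero]
    have h0 : Tendsto (fun t : ℝ => cosKernel (0:ℝ) (1 / ((a:ℝ) ^ 2 * t)) - 1) (𝓝[>] 0) (𝓝 0) := by
      simpa using ((vdb_cos_lim ((0:ℝ) : UnitAddCircle)).comp hlim).sub_const 1
    refine squeeze_zero' (Eventually.of_forall fun _ => norm_nonneg _) ?_ h0
    filter_upwards [self_mem_nhdsWithin] with t ht
    have him : (I / (a ^ 2 * t) - 1 / a : ℂ).im = 1 / ((a:ℝ) ^ 2 * t) := by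
      have : (I / (a ^ 2 * t) - 1 / a : ℂ) = ((-1 / a : ℝ) : ℂ) + ((1 / ((a:ℝ) ^ 2 * t) : ℝ) : ℂ) * I := by
        push_cast; ring
      rw [this]
      simp only [add_im, ofReal_im, mul_I_im, ofReal_re, zero_add]
    have := vdb_theta_bound (-c / (2 * a)) (I / (a ^ 2 * t) - 1 / a) (by
      rw [him]; have : (0:ℝ) < t := ht
      positivity)
    rw [him] at this
    exact this
  have h0 : Tendsto (fun t : ℝ => (t : ℂ)) (𝓝[>] 0) (𝓝 0) := by
    have := (continuous_ofReal.tendsto 0).mono_left (nhdsWithin_le_nhds (s := Set.Ioi 0))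
    simpa using this
  have hden : Tendsto (fun t : ℝ => (1 + I * a * t : ℂ)) (𝓝[>] 0) (𝓝 1) := by
    simpa using (h0.const_mul (I * a)).const_add 1
  have hA : Tendsto (fun t : ℝ => 1 / (t + -I / a : ℂ) ^ (1 / 2 : ℂ)) (𝓝[>] 0)
      (𝓝 (1 / (-I / a : ℂ) ^ (1 / 2 : ℂ))) := by
    refine Tendsto.div tendsto_const_nhds ?_ ?_
    · have hs : (-I / a : ℂ) ∈ slitPlane := by
        rw [mem_slitPlane_iff]; right
        have : (-I / a : ℂ) = ((-1 / a : ℝ) : ℂ) * I := by push_cast; ring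
        rw [this]
        simp only [mul_I_im, ofReal_re]
        exact (div_neg_of_neg_of_pos (by norm_num) haR).ne
      have := (h0.add_const (-I / a : ℂ))
      rw [zero_add] at this
      exact this.cpow tendsto_const_nhds hs
    · rw [Complex.cpow_ne_zero_iff_of_exponent_ne_zero (by norm_num)]
      simp [ha', I_ne_zero]
  have hB : Tendsto (fun t : ℝ => cexp (-Real.pi * I * (c ^ 2 / (4 * a)) / (1 + I * a * t))) (𝓝[>] 0)
      (𝓝 (cexp (-Real.pi * I * (c ^ 2 / (4 * a))))) := by
    refine (continuous_exp.tendsto _).comp ?_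
    have := (tendsto_const_nhds (x := (-Real.pi * I * (c ^ 2 / (4 * a)) : ℂ))).div hden one_ne_zero
    rw [div_one] at this
    exact this
  have hC : Tendsto (fun t : ℝ => (1 / ((a ^ 2 / (1 + I * a * t) : ℂ)) ^ (1 / 2 : ℂ))) (𝓝[>] 0)
      (𝓝 (1 / ((a:ℂ) ^ 2) ^ (1 / 2 : ℂ))) := by
    refine Tendsto.div tendsto_const_nhds ?_ ?_
    · have := (tendsto_const_nhds (x := ((a:ℂ) ^ 2))).div hden one_ne_zero
      rw [div_one] at this
      refine this.cpow tendsto_const_nhds ?_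
      rw [mem_slitPlane_iff]; left
      have : ((a:ℂ) ^ 2) = (((a:ℝ) ^ 2 : ℝ) : ℂ) := by push_cast; rfl
      rw [this, ofReal_re]; positivity
    · rw [Complex.cpow_ne_zero_iff_of_exponent_ne_zero (by norm_num)]
      simp [ha']
  have hD : Tendsto (fun t : ℝ => cexp (Real.pi * c ^ 2 * t / (4 * (1 + I * a * t)))) (𝓝[>] 0) (𝓝 1) := by
    have := (continuous_exp.tendsto _).comp
      ((h0.const_mul (Real.pi * c ^ 2 : ℂ)).div (hden.const_mul 4) (by norm_num))
    simpa [Function.comp_def] using this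
  have := (hA.mul hB).mul ((hC.mul hD).mul hU)
  rw [mul_one, mul_one] at this
  refine this.congr' ?_
  filter_upwards [self_mem_nhdsWithin] with t ht
  have ht : 0 < t := ht
  have h1 : (1 + I * a * t : ℂ) ≠ 0 := by
    intro h
    have := congrArg Complex.re h
    simp at this
  rw [vdb_theta_id a c ha hc t ht, vdb_cpow t ht _ (div_ne_zero (pow_ne_zero 2 ha') h1)]
  have : (Real.sqrt t : ℂ) ≠ 0 := by exact_mod_cast (Real.sqrt_pos.mpr ht).ne'
  field_simp

open Complex Filter Topology HurwitzZeta in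
theorem vdb_gauss_pos (a c : ℤ) (ha : 0 < a) (hc : (2:ℤ) ∣ c - a) (N : ℕ) [NeZero N] (haN : a ∣ N) :
    ∃ r : ℝ, 0 < r ∧ ∑ k : Fin N, cexp (Real.pi * I * (((k : ℕ) : ℝ) ^ 2 + c * ((k : ℕ) : ℝ)) / a) =
      r * cexp (Real.pi * I * (1 - (c : ℝ) ^ 2 / a) / 4) := by
  have ha' : (a : ℂ) ≠ 0 := by exact_mod_cast ha.ne'
  have haR : (0 : ℝ) < a := by exact_mod_cast ha
  have hN : (N : ℂ) ≠ 0 := by exact_mod_cast NeZero.ne N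
  have hNR : (0 : ℝ) < N := by exact_mod_cast Nat.pos_of_ne_zero (NeZero.ne N)
  have h1 := vdb_theta_lim a c ha hc
  have h2 := vdb_avg (fun k : ℤ => cexp (Real.pi * I * (k ^ 2 + c * k) / a)) N ?_
    (fun t : ℝ => jacobiTheta₂ (c / (2 * a)) (1 / a + I * t)) ?_
  · have h3 := tendsto_nhds_unique h2 h1
    refine ⟨N * (1 / Real.sqrt a), by positivity, ?_⟩
    have h4 : ((a:ℂ) ^ 2) ^ (1 / 2 : ℂ) = a := by
      have : ((a:ℂ) ^ 2) = (((a:ℝ) ^ 2 : ℝ) : ℂ) := by push_cast; rfl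
      rw [this, show (1 / 2 : ℂ) = ((1 / 2 : ℝ) : ℂ) by push_cast; rfl, ← ofReal_cpow (by positivity),
        ← Real.sqrt_eq_rpow, Real.sqrt_sq haR.le]
      simp
    have h5 : (-I / a : ℂ) ^ (1 / 2 : ℂ) = (Real.sqrt (1 / a) : ℂ) * cexp (-(Real.pi * I / 4)) := by
      have : (-I / a : ℂ) = ((1 / a : ℝ) : ℂ) * (-I) := by push_cast; ring
      rw [this, vdb_cpow _ (by positivity) _ (by simp [I_ne_zero]),
        cpow_def_of_ne_zero (by simp [I_ne_zero]), log_neg_I]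
      congr 2; ring
    rw [h4, h5] at h3
    have h6 : ∑ k : Fin N, cexp (Real.pi * I * (((k : ℕ) : ℝ) ^ 2 + c * ((k : ℕ) : ℝ)) / a) =
      ∑ k : Fin N, cexp (Real.pi * I * ((((k : ℕ) : ℤ) : ℂ) ^ 2 + c * (((k : ℕ) : ℤ) : ℂ)) / a) := by
      push_cast; rfl
    rw [h6, (div_eq_iff hN).mp h3]
    have h7 : (Real.pi * I * (1 - (c : ℝ) ^ 2 / a) / 4 : ℂ) =
      -(-(Real.pi * I / 4)) + (-Real.pi * I * (c ^ 2 / (4 * a))) := by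
      push_cast; field_simp; ring
    have h8 : (a : ℂ) = (Real.sqrt a : ℂ) * (Real.sqrt a : ℂ) := by
      rw [← ofReal_mul, Real.mul_self_sqrt haR.le]; simp
    have h9 : (Real.sqrt a : ℂ) ≠ 0 := by exact_mod_cast (Real.sqrt_pos.mpr haR).ne'
    have h10 := Complex.exp_ne_zero (-(Real.pi * I / 4))
    rw [h7, Complex.exp_add, Complex.exp_neg (-(Real.pi * I / 4))]
    generalize cexp (-(Real.pi * I / 4)) = A at h10 ⊢
    generalize cexp (-Real.pi * I * (c ^ 2 / (4 * a))) = B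
    rw [Real.sqrt_div zero_le_one, Real.sqrt_one]
    push_cast
    rw [h8]
    generalize (Real.sqrt a : ℂ) = s at h9 ⊢
    field_simp
  · intro k m
    rw [Complex.exp_eq_exp_iff_exists_int]
    obtain ⟨b, hb⟩ := haN
    obtain ⟨e, he⟩ := hc
    have : ∃ q : ℤ, b * m * (a * b * m + c) = 2 * q := by
      have hc : c = a + 2 * e := by linarith
      obtain ⟨f, hf⟩ := Int.even_mul_succ_self (b * m)
      refine ⟨a * f + b * m * e, ?_⟩
      rw [hc]; linear_combination a * hf
    obtain ⟨q, hq⟩ := this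
    refine ⟨k * b * m + q, ?_⟩
    have hb' : (N : ℂ) = a * b := by exact_mod_cast hb
    have hq' : (b * m * (a * b * m + c) : ℂ) = 2 * q := by exact_mod_cast hq
    push_cast
    rw [hb']
    field_simp
    linear_combination (a : ℂ) * hq'
  · intro t ht
    convert hasSum_jacobiTheta₂_term (c / (2 * a)) (τ := 1 / a + I * t) ?_ using 1
    · ext n
      rw [jacobiTheta₂_term, ofReal_exp, ← Complex.exp_add]
      congr 1
      push_cast
      field_simp
      linear_combination (-n ^ 2 * t * a : ℂ) * I_sq
    · have : (1 / a : ℂ) = ((1 / a : ℝ) : ℂ) := by push_cast; rfl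
      rw [this, add_im, ofReal_im]
      simpa using ht

open Complex in
theorem vdb_gauss (a c : ℤ) (ha : a ≠ 0) (hc : (2:ℤ) ∣ c - a) (N : ℕ) [NeZero N] (haN : a ∣ N) :
    ∃ r : ℝ, 0 < r ∧ ∑ k : Fin N, cexp (Real.pi * I * (((k : ℕ) : ℝ) ^ 2 + c * ((k : ℕ) : ℝ)) / a) =
      r * cexp (Real.pi * I * (a.sign - (c : ℝ) ^ 2 / a) / 4) := by
  rcases lt_or_gt_of_ne ha with h | h
  · obtain ⟨r, hr, e⟩ := vdb_gauss_pos (-a) c (by omega) (by omega) N (by simpa using haN)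
    refine ⟨r, hr, ?_⟩
    have e2 := congrArg (starRingEnd ℂ) e
    rw [map_sum, map_mul, conj_ofReal, ← Complex.exp_conj] at e2
    simp only [← Complex.exp_conj] at e2
    rw [Int.sign_eq_neg_one_of_neg h]
    convert e2 using 3
    · simp
    · have h4 : (starRingEnd ℂ) 4 = 4 := map_ofNat _ 4
      simp [h4]
      ring
  · obtain ⟨r, hr, e⟩ := vdb_gauss_pos a c h hc N haN
    refine ⟨r, hr, ?_⟩
    rw [Int.sign_eq_one_of_pos h]
    simpa using e

open Complex in
theorem vdb_per (a c : ℤ) (ha : a ≠ 0) (hc : (2:ℤ) ∣ c - a) (N : ℕ) (haN : a ∣ N) (k m : ℤ) :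
    cexp (Real.pi * I * (((k + N * m : ℤ) : ℝ) ^ 2 + c * ((k + N * m : ℤ) : ℝ)) / a) =
    cexp (Real.pi * I * ((k : ℝ) ^ 2 + c * (k : ℝ)) / a) := by
  have ha' : (a : ℂ) ≠ 0 := by exact_mod_cast ha
  rw [Complex.exp_eq_exp_iff_exists_int]
  obtain ⟨b, hb⟩ := haN
  obtain ⟨e, he⟩ := hc
  have : ∃ q : ℤ, b * m * (a * b * m + c) = 2 * q := by
    have hc : c = a + 2 * e := by linarith
    obtain ⟨f, hf⟩ := Int.even_mul_succ_self (b * m)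
    refine ⟨a * f + b * m * e, ?_⟩
    rw [hc]; linear_combination a * hf
  obtain ⟨q, hq⟩ := this
  refine ⟨k * b * m + q, ?_⟩
  have hb' : (N : ℂ) = a * b := by exact_mod_cast hb
  have hq' : (b * m * (a * b * m + c) : ℂ) = 2 * q := by exact_mod_cast hq
  push_cast
  rw [hb']
  field_simp
  linear_combination (a : ℂ) * hq'

theorem vdb_shift {n N : ℕ} [NeZero N] (F : (Fin n → ℤ) → ℂ)
    (hF : ∀ k m : Fin n → ℤ, F (fun i => k i + N * m i) = F k) (h : Fin n → ℤ) :
    ∑ k : Fin n → Fin N, F (fun i => ((k i : ℕ) : ℤ) + h i) =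
      ∑ k : Fin n → Fin N, F (fun i => ((k i : ℕ) : ℤ)) := by
  have hN : (0 : ℤ) < N := by exact_mod_cast Nat.pos_of_ne_zero (NeZero.ne N)
  let s : Fin n → Fin N := fun i => Fin.ofNat N (h i % N).toNat
  rw [← Equiv.sum_comp (Equiv.addRight s) (fun k : Fin n → Fin N => F (fun i => ((k i : ℕ) : ℤ)))]
  refine Finset.sum_congr rfl fun k _ => ?_
  rw [← hF (fun i => (((Equiv.addRight s k) i : ℕ) : ℤ)) (fun i => (((k i : ℕ) : ℤ) + h i) / N)]
  congr 1
  ext i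
  have h1 : (((k i + s i : Fin N) : ℕ) : ℤ) = (((k i : ℕ) : ℤ) + h i) % N := by
    rw [Fin.val_add]
    simp only [s, Fin.ofNat]
    push_cast
    rw [Int.toNat_of_nonneg (Int.emod_nonneg _ hN.ne')]
    simp
  simp only [Equiv.coe_addRight, Pi.add_apply, h1]
  rw [Int.emod_add_mul_ediv]

open Complex Classical in
theorem vdb_geom (N : ℕ) [NeZero N] (x : ℝ) (h : ∃ m : ℤ, N * x = m) :
    ∑ y : Fin N, cexp (2 * Real.pi * I * (x * ((y : ℕ) : ℝ) : ℝ)) =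
      if (∃ m : ℤ, x = m) then (N : ℂ) else 0 := by
  have h1 : ∀ y : Fin N, cexp (2 * Real.pi * I * (x * ((y : ℕ) : ℝ) : ℝ)) =
      cexp (2 * Real.pi * I * x) ^ (y : ℕ) := by
    intro y
    rw [← Complex.exp_nat_mul]
    congr 1; push_cast; ring
  rw [Finset.sum_congr rfl fun y _ => h1 y]
  split_ifs with hx
  · obtain ⟨m, rfl⟩ := hx
    have : cexp (2 * Real.pi * I * ((m : ℝ) : ℂ)) = 1 := by
      rw [Complex.exp_eq_one_iff]; exact ⟨m, by push_cast; ring⟩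
    simp only [this]; simp
  · have hne : cexp (2 * Real.pi * I * x) ≠ 1 := by
      intro h
      rw [Complex.exp_eq_one_iff] at h
      obtain ⟨m, hm⟩ := h
      refine hx ⟨m, ?_⟩
      have h2 : (2 * Real.pi * I : ℂ) ≠ 0 := Complex.two_pi_I_ne_zero
      have : (x : ℂ) = (m : ℂ) := mul_left_cancel₀ h2 (by rw [hm]; ring)
      exact_mod_cast this
    rw [Fin.sum_univ_eq_sum_range (fun y => cexp (2 * Real.pi * I * x) ^ y), geom_sum_eq hne]
    rw [← Complex.exp_nat_mul]
    obtain ⟨m, hm⟩ := h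
    have : cexp (N * (2 * Real.pi * I * x)) = 1 := by
      rw [Complex.exp_eq_one_iff]
      have hm' : (N : ℂ) * x = m := by exact_mod_cast hm
      exact ⟨m, by linear_combination (2 * Real.pi * I) * hm'⟩
    rw [this]; simp

/-- An abstract form of the lattice part. -/
theorem vdb_lattice {n : ℕ} (M B : Matrix (Fin n) (Fin n) ℤ) (hsym : Mᵀ = M)
    (hdet : M.det = 1 ∨ M.det = -1) (v : Fin n → ℤ)
    (hv : ∀ u : Fin n → ℤ, u ⬝ᵥ M.mulVec u ≡ u ⬝ᵥ M.mulVec v [ZMOD 2])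
    (a : Fin n → ℤ) (ha : ∀ i, a i ≠ 0) (hB : Bᵀ * M * B = Matrix.diagonal a) :
    ∑ i, (a i).sign ≡ v ⬝ᵥ M.mulVec v [ZMOD 8] := by
  classical
  -- real objects
  let Mr : Matrix (Fin n) (Fin n) ℝ := M.map (Int.cast : ℤ → ℝ)
  let Br : Matrix (Fin n) (Fin n) ℝ := B.map (Int.cast : ℤ → ℝ)
  let E : Matrix (Fin n) (Fin n) ℝ := Matrix.diagonal fun i => (1 / a i : ℝ)
  let W := Mr * Br * E
  let R : (Fin n → ℤ) → (Fin n → ℝ) := fun x i => (x i : ℝ)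
  have haR : ∀ i, (a i : ℝ) ≠ 0 := fun i => by exact_mod_cast ha i
  have hMs : Mrᵀ = Mr := by
    rw [← Matrix.transpose_map, hsym]
  have hBr : Brᵀ * Mr * Br = Matrix.diagonal fun i => (a i : ℝ) := by
    have := congrArg (fun A : Matrix (Fin n) (Fin n) ℤ => A.map (Int.castRingHom ℝ)) hB
    simp only [Matrix.map_mul] at this
    rw [Matrix.diagonal_map (by simp)] at this
    exact this
  have hW1 : Brᵀ * W = 1 := by
    rw [← Matrix.mul_assoc, ← Matrix.mul_assoc, hBr, Matrix.diagonal_mul_diagonal]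
    rw [← Matrix.diagonal_one]
    congr 1; ext i; field_simp [haR i]
  have hW2 : W * Brᵀ = 1 := mul_eq_one_comm.mp hW1
  have hWt : Wᵀ = E * Brᵀ * Mr := by
    simp only [W, Matrix.transpose_mul, hMs, E, Matrix.diagonal_transpose, Matrix.mul_assoc]
  -- integer map y ↦ h y = Bᵀ M y
  let h : (Fin n → ℤ) → (Fin n → ℤ) := fun y => Bᵀ *ᵥ (M *ᵥ y)
  have hRM : ∀ y, R (M *ᵥ y) = Mr *ᵥ R y := by
    intro y; ext i; simp [R, Mr, Matrix.mulVec, dotProduct]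
  have hRB : ∀ y, R (Bᵀ *ᵥ y) = Brᵀ *ᵥ R y := by
    intro y; ext i; simp [R, Br, Matrix.mulVec, dotProduct]
  have hRh : ∀ y, R (h y) = Brᵀ *ᵥ (Mr *ᵥ R y) := by
    intro y; rw [hRB, hRM]
  have hRd : ∀ x y, ((x ⬝ᵥ y : ℤ) : ℝ) = R x ⬝ᵥ R y := by
    intro x y; simp [R, dotProduct]
  let br : (Fin n → ℝ) → (Fin n → ℝ) → ℝ := fun x y => x ⬝ᵥ (E *ᵥ y)
  have hbr : ∀ x y, br x y = ∑ i, x i * y i / a i := by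
    intro x y
    simp only [br, E, Matrix.mulVec_diagonal, dotProduct]
    exact Finset.sum_congr rfl fun i _ => by ring
  have fact1 : ∀ (x : Fin n → ℝ) (y : Fin n → ℤ), br x (R (h y)) = (W *ᵥ x) ⬝ᵥ R y := by
    intro x y
    simp only [br]
    rw [hRh, Matrix.mulVec_mulVec, Matrix.mulVec_mulVec, ← hWt,
      Matrix.dotProduct_mulVec, Matrix.vecMul_transpose]
  have fact2 : ∀ x y, br (R (h x)) (R (h y)) = ((y ⬝ᵥ M *ᵥ x : ℤ) : ℝ) := by
    intro x y
    rw [fact1, hRh, Matrix.mulVec_mulVec, hW2, Matrix.one_mulVec, hRd, hRM, dotProduct_comm]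
  let c := h v
  have hca : ∀ i, (2 : ℤ) ∣ c i - a i := by
    intro i
    have h1 := hv (B.col i)
    have h2 : B.col i ⬝ᵥ M *ᵥ v = c i := rfl
    have h3 : B.col i ⬝ᵥ M *ᵥ B.col i = a i := by
      have := congrFun (congrFun hB i) i
      rw [Matrix.diagonal_apply_eq, Matrix.mul_assoc] at this
      rw [← this]
      rfl
    rw [h2, h3] at h1
    exact h1.dvd
  let q : (Fin n → ℝ) → ℝ := fun x => br x x + br (R c) x
  have hbadd : ∀ x y z, br x (y + z) = br x y + br x z := by
    intro x y z; simp only [br, Matrix.mulVec_add, dotProduct_add]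
  have hbadd' : ∀ x y z, br (y + z) x = br y x + br z x := by
    intro x y z; simp only [br, add_dotProduct]
  have hbcomm : ∀ x y, br x y = br y x := by
    intro x y; rw [hbr, hbr]; exact Finset.sum_congr rfl fun i _ => by ring
  have heven : ∀ y, ∃ m : ℤ, q (R (h y)) = 2 * m := by
    intro y
    have h1 := (hv y)
    have h2 : (2 : ℤ) ∣ y ⬝ᵥ M *ᵥ y + y ⬝ᵥ M *ᵥ v := by
      have := h1.dvd
      omega
    obtain ⟨m, hm⟩ := h2
    refine ⟨m, ?_⟩
    simp only [q, c]
    rw [fact2, fact2]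
    exact_mod_cast hm
  have hqadd : ∀ x y, ∃ m : ℤ, q (x + R (h y)) = q x + 2 * ((W *ᵥ x) ⬝ᵥ R y) + 2 * m := by
    intro x y
    obtain ⟨m, hm⟩ := heven y
    refine ⟨m, ?_⟩
    rw [← hm, ← fact1]
    simp only [q, hbadd, hbadd']
    rw [hbcomm (R (h y)) x]
    ring
  -- good points
  have hgood : ∀ k : Fin n → ℤ, (∀ j, ∃ m : ℤ, (W *ᵥ R k) j = m) → ∃ m : ℤ, q (R k) = 2 * m := by
    intro k hk
    choose t ht using hk
    have ht' : W *ᵥ R k = R t := funext ht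
    have hk2 : R k = Brᵀ *ᵥ R t := by
      rw [← ht', Matrix.mulVec_mulVec, hW1, Matrix.one_mulVec]
    have hu : IsUnit M.det := by
      rcases hdet with h | h <;> rw [h] <;> simp
    have hx : M *ᵥ (M⁻¹ *ᵥ t) = t := by
      rw [Matrix.mulVec_mulVec, Matrix.mul_nonsing_inv _ hu, Matrix.one_mulVec]
    have : R k = R (h (M⁻¹ *ᵥ t)) := by
      rw [hk2, hRh, ← hRM, hx]
    rw [this]; exact heven _
  -- the modulus
  let N : ℕ := ∏ i, (a i).natAbs
  have hN0 : N ≠ 0 := Finset.prod_ne_zero_iff.mpr fun i _ => Int.natAbs_ne_zero.mpr (ha i)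
  have : NeZero N := ⟨hN0⟩
  have haN : ∀ i, a i ∣ (N : ℤ) := by
    intro i
    rw [← Int.natAbs_dvd]
    exact_mod_cast Finset.dvd_prod_of_mem _ (Finset.mem_univ i)
  have hWN : ∀ (k : Fin n → ℤ) j, ∃ m : ℤ, N * (W *ᵥ R k) j = m := by
    intro k j
    choose b hb using haN
    have hb' : ∀ i, (N : ℝ) = a i * b i := fun i => by exact_mod_cast hb i
    refine ⟨∑ i, (M * B) j i * b i * k i, ?_⟩
    have hMB : ∀ i, (((M * B) j i : ℤ) : ℝ) = (Mr * Br) j i := by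
      intro i; simp [Matrix.mul_apply, Mr, Br]
    push_cast
    simp only [hMB, W, E, R, Matrix.mulVec, dotProduct, Matrix.mul_diagonal]
    rw [Finset.mul_sum]
    refine Finset.sum_congr rfl fun i _ => ?_
    rw [hb' i]
    field_simp [haR i]
  let g : Fin n → ℤ → ℂ := fun i x =>
    Complex.exp (Real.pi * Complex.I * ((x : ℝ) ^ 2 + c i * (x : ℝ)) / a i)
  let F : (Fin n → ℤ) → ℂ := fun k => ∏ i, g i (k i)
  have hF : ∀ k, F k = Complex.exp (Real.pi * Complex.I * (q (R k) : ℝ)) := by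
    intro k
    simp only [F, g]
    rw [← Complex.exp_sum]
    congr 1
    simp only [q]
    rw [hbr, hbr, ← Finset.sum_add_distrib]
    push_cast
    rw [Finset.mul_sum]
    refine Finset.sum_congr rfl fun i _ => ?_
    simp only [R]
    push_cast
    ring
  have hFper : ∀ k m : Fin n → ℤ, F (fun i => k i + N * m i) = F k := by
    intro k m
    exact Finset.prod_congr rfl fun i _ => vdb_per (a i) (c i) (ha i) (hca i) N (haN i) (k i) (m i)
  let G : ℂ := ∑ k : Fin n → Fin N, F (fun i => ((k i : ℕ) : ℤ))
  have hG1 : ∃ r : ℝ, 0 < r ∧ G = r * Complex.exp (Real.pi * Complex.I *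
      ((∑ i, (a i).sign : ℤ) - (v ⬝ᵥ M *ᵥ v : ℤ)) / 4) := by
    choose r hr hr2 using fun i => vdb_gauss (a i) (c i) (ha i) (hca i) N (haN i)
    refine ⟨∏ i, r i, Finset.prod_pos fun i _ => hr i, ?_⟩
    have h1 : G = ∏ i, ∑ k : Fin N, g i ((k : ℕ) : ℤ) := by
      rw [Finset.prod_univ_sum]
      simp [G, F]
    have h2 : ∀ i, ∑ k : Fin N, g i ((k : ℕ) : ℤ) = r i * Complex.exp (Real.pi * Complex.I *
      ((a i).sign - (c i : ℝ) ^ 2 / a i) / 4) := by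
      intro i
      rw [← hr2 i]
      simp [g]
    rw [h1, Finset.prod_congr rfl fun i _ => h2 i, Finset.prod_mul_distrib, ← Complex.exp_sum]
    have h3 : ((v ⬝ᵥ M *ᵥ v : ℤ) : ℂ) = ∑ i, ((c i : ℝ) : ℂ) ^ 2 / a i := by
      have := fact2 v v
      rw [hbr] at this
      have h4 := congrArg (fun x : ℝ => (x : ℂ)) this
      push_cast at h4
      rw [← h4]
      refine Finset.sum_congr rfl fun i _ => ?_
      simp only [R, c]
      push_cast; ring
    rw [h3]
    push_cast
    congr 2
    rw [← Finset.sum_sub_distrib, Finset.mul_sum, Finset.sum_div]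
  have hG2 : ∃ r : ℝ, 0 < r ∧ G = r := by
    have hsh : ∀ y : Fin n → Fin N, G = ∑ k : Fin n → Fin N, F (fun i => ((k i : ℕ) : ℤ)) *
        ∏ j, Complex.exp (2 * Real.pi * Complex.I *
          ((W *ᵥ R (fun i => ((k i : ℕ) : ℤ))) j * (((y j : ℕ)) : ℝ) : ℝ)) := by
      intro y
      simp only [G]
      rw [← vdb_shift F hFper (h fun i => ((y i : ℕ) : ℤ))]
      refine Finset.sum_congr rfl fun k _ => ?_
      rw [hF, hF, ← Complex.exp_sum, ← Complex.exp_add]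
      obtain ⟨m, hm⟩ := hqadd (R (fun i => ((k i : ℕ) : ℤ))) (fun i => ((y i : ℕ) : ℤ))
      have e1 : R (fun i => ((k i : ℕ) : ℤ) + h (fun i => ((y i : ℕ) : ℤ)) i) =
        R (fun i => ((k i : ℕ) : ℤ)) + R (h (fun i => ((y i : ℕ) : ℤ))) := by
        ext i; simp [R]
      rw [e1, hm, Complex.exp_eq_exp_iff_exists_int]
      refine ⟨m, ?_⟩
      rw [← Finset.mul_sum]
      simp only [dotProduct]
      simp only [R]
      push_cast
      ring
    have hsum : (N : ℂ) ^ n * G = (N : ℂ) ^ n * ((Finset.univ.filter fun k : Fin n → Fin N =>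
        ∀ j, ∃ m : ℤ, (W *ᵥ R (fun i => ((k i : ℕ) : ℤ))) j = m).card : ℂ) := by
      have h1 : (N : ℂ) ^ n * G = ∑ y : Fin n → Fin N, G := by simp
      rw [h1, Finset.sum_congr rfl fun y _ => hsh y, Finset.sum_comm]
      have h2 : ∀ k : Fin n → Fin N, ∑ y : Fin n → Fin N, F (fun i => ((k i : ℕ) : ℤ)) *
        ∏ j, Complex.exp (2 * Real.pi * Complex.I *
          ((W *ᵥ R (fun i => ((k i : ℕ) : ℤ))) j * (((y j : ℕ)) : ℝ) : ℝ)) =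
          if (∀ j, ∃ m : ℤ, (W *ᵥ R (fun i => ((k i : ℕ) : ℤ))) j = m) then (N : ℂ) ^ n else 0 := by
        intro k
        rw [← Finset.mul_sum]
        have h3 := Finset.prod_univ_sum (fun _ : Fin n => (Finset.univ : Finset (Fin N)))
          (fun j y => Complex.exp (2 * Real.pi * Complex.I *
          ((W *ᵥ R (fun i => ((k i : ℕ) : ℤ))) j * (((y : ℕ)) : ℝ) : ℝ)))
        rw [Fintype.piFinset_univ] at h3
        rw [← h3, Finset.prod_congr rfl fun j _ => vdb_geom N _ (hWN _ j)]
        split_ifs with hk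
        · rw [Finset.prod_congr rfl fun j _ => if_pos (hk j)]
          obtain ⟨m, hm⟩ := hgood _ hk
          have : F (fun i => ((k i : ℕ) : ℤ)) = 1 := by
            rw [hF, hm, Complex.exp_eq_one_iff]
            exact ⟨m, by push_cast; ring⟩
          rw [this]; simp
        · push Not at hk
          obtain ⟨j, hj⟩ := hk
          rw [Finset.prod_eq_zero (Finset.mem_univ j), mul_zero]
          rw [if_neg]
          push Not
          exact hj
      rw [Finset.sum_congr rfl fun k _ => h2 k, ← Finset.sum_filter, Finset.sum_const, nsmul_eq_mul,
        mul_comm]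
    have hNC : (N : ℂ) ^ n ≠ 0 := pow_ne_zero _ (by exact_mod_cast hN0)
    have := mul_left_cancel₀ hNC hsum
    refine ⟨_, ?_, by rw [this, Complex.ofReal_natCast]⟩
    have : 0 < (Finset.univ.filter fun k : Fin n → Fin N =>
        ∀ j, ∃ m : ℤ, (W *ᵥ R (fun i => ((k i : ℕ) : ℤ))) j = m).card := by
      refine Finset.card_pos.mpr ⟨fun _ => 0, ?_⟩
      rw [Finset.mem_filter]
      refine ⟨Finset.mem_univ _, fun j => ⟨0, ?_⟩⟩
      have : R (fun i => (((0 : Fin N) : ℕ) : ℤ)) = 0 := by ext i; simp [R]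
      rw [this]; simp
    exact_mod_cast this
  obtain ⟨r, hr, e1⟩ := hG1
  obtain ⟨s, hs, e2⟩ := hG2
  set d : ℤ := ∑ i, (a i).sign - v ⬝ᵥ M *ᵥ v with hd
  have e3 : Complex.exp (Real.pi * Complex.I *
      ((∑ i, (a i).sign : ℤ) - (v ⬝ᵥ M *ᵥ v : ℤ)) / 4) = Complex.exp ((Real.pi * d / 4 : ℝ) * Complex.I) := by
    congr 1
    rw [hd]; push_cast; ring
  rw [e3] at e1
  have e4 : r = s := by
    have := congrArg norm (e1.symm.trans e2)
    rw [norm_mul, Complex.norm_exp_ofReal_mul_I, mul_one, Complex.norm_of_nonneg hr.le,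
      Complex.norm_of_nonneg hs.le] at this
    exact this
  have e5 : Complex.exp ((Real.pi * d / 4 : ℝ) * Complex.I) = 1 := by
    have h1 : (r : ℂ) ≠ 0 := by exact_mod_cast hr.ne'
    apply mul_left_cancel₀ h1
    rw [mul_one, ← e1, e2, e4]
  rw [Complex.exp_eq_one_iff] at e5
  obtain ⟨m, hm⟩ := e5
  have h8 : (d : ℂ) = 8 * m := by
    have h2 : (2 * Real.pi * Complex.I : ℂ) ≠ 0 := Complex.two_pi_I_ne_zero
    apply mul_left_cancel₀ h2
    push_cast at hm
    linear_combination 8 * hm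
  have h9 : d = 8 * m := by exact_mod_cast h8
  exact (Int.modEq_iff_dvd.mpr ⟨m, by rw [← h9, hd]⟩ : v ⬝ᵥ M *ᵥ v ≡ ∑ i, (a i).sign [ZMOD 8]).symm

theorem vdb_sig {n : ℕ} (A P : Matrix (Fin n) (Fin n) ℝ) (hP : IsUnit P.det) (d : Fin n → ℝ)
    (h : Pᵀ * A * P = Matrix.diagonal d) :
    sigPos (A.toQuadraticForm') = (Finset.univ.filter (fun i : Fin n => 0 < d i)).card ∧
    sigNeg (A.toQuadraticForm') = (Finset.univ.filter (fun i : Fin n => d i < 0)).card := by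
  have key : ∀ x : Fin n → ℝ, (A.toQuadraticForm') (P *ᵥ x) =
      QuadraticMap.weightedSumSquares ℝ d x := by
    intro x
    have h1 : (A.toQuadraticForm') (P *ᵥ x) = (P *ᵥ x) ⬝ᵥ (A *ᵥ (P *ᵥ x)) := by
      simp [Matrix.toQuadraticForm', Matrix.toLinearMap₂'_apply']
    have h2 : (P *ᵥ x) ⬝ᵥ (A *ᵥ (P *ᵥ x)) = x ⬝ᵥ ((Pᵀ * A * P) *ᵥ x) := by
      rw [← Matrix.mulVec_mulVec, ← Matrix.mulVec_mulVec, Matrix.dotProduct_mulVec x,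
        Matrix.vecMul_transpose]
    rw [h1, h2, h, QuadraticMap.weightedSumSquares_apply]
    simp only [dotProduct, Matrix.mulVec_diagonal, smul_eq_mul]
    exact Finset.sum_congr rfl fun i _ => by ring
  have eqv : QuadraticMap.Equivalent (A.toQuadraticForm') (QuadraticMap.weightedSumSquares ℝ d) := by
    refine QuadraticMap.Equivalent.symm ⟨⟨Matrix.toLinearEquiv' P (Matrix.invertibleOfIsUnitDet P hP), ?_⟩⟩
    intro x
    exact key x
  rw [QuadraticForm.sigPos_of_equiv_weightedSumSquares eqv,
    QuadraticForm.sigNeg_of_equiv_weightedSumSquares eqv]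
  constructor <;> rw [← Set.ncard_coe_finset] <;> simp

theorem vdb_exists {n : ℕ} (M : Matrix (Fin n) (Fin n) ℤ) (hsym : Mᵀ = M) :
    ∃ (B : Matrix (Fin n) (Fin n) ℤ) (a : Fin n → ℤ), B.det ≠ 0 ∧ Bᵀ * M * B = Matrix.diagonal a := by
  classical
  let Mq : Matrix (Fin n) (Fin n) ℚ := M.map (Int.cast : ℤ → ℚ)
  have hMs : Mqᵀ = Mq := by
    rw [← Matrix.transpose_map, hsym]
  let φ : LinearMap.BilinForm ℚ (Fin n → ℚ) := Matrix.toBilin' Mq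
  have hφ : ∀ x y, φ x y = x ⬝ᵥ Mq *ᵥ y := fun x y => Matrix.toBilin'_apply' _ _ _
  have hs : LinearMap.IsSymm φ := by
    refine ⟨fun x y => ?_⟩
    rw [hφ, RingHom.id_apply, hφ, Matrix.dotProduct_mulVec, ← Matrix.mulVec_transpose, hMs, dotProduct_comm]
  obtain ⟨b0, hb0⟩ := LinearMap.BilinForm.exists_orthogonal_basis hs
  let b := b0.reindex (finCongr (Module.finrank_fin_fun ℚ))
  have hb : ∀ i j, i ≠ j → φ (b i) (b j) = 0 := by
    intro i j hij
    simp only [b, Module.Basis.reindex_apply]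
    exact hb0 (fun h => hij (by simpa using h))
  obtain ⟨N, hN⟩ := IsLocalization.exist_integer_multiples_of_finite (nonZeroDivisors ℤ)
    (fun p : Fin n × Fin n => b p.2 p.1)
  choose B hB using hN
  have hN0 : ((N : ℤ) : ℚ) ≠ 0 := by exact_mod_cast nonZeroDivisors.ne_zero N.2
  have hB' : ∀ i j, (B (i, j) : ℚ) = ((N : ℤ) : ℚ) * b j i := by
    intro i j
    have := hB (i, j)
    simpa using this
  let Bm : Matrix (Fin n) (Fin n) ℤ := Matrix.of fun i j => B (i, j)
  let V : Matrix (Fin n) (Fin n) ℚ := Matrix.of fun i j => b j i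
  have hV : V.det ≠ 0 := by
    have : LinearIndependent ℚ V.col := b.linearIndependent
    rw [Matrix.linearIndependent_cols_iff_isUnit, Matrix.isUnit_iff_isUnit_det] at this
    exact this.ne_zero
  have hBV : Bm.map (Int.castRingHom ℚ) = ((N : ℤ) : ℚ) • V := by
    ext i j; simp [Bm, V, hB']
  refine ⟨Bm, fun i => (Bmᵀ * M * Bm) i i, ?_, ?_⟩
  · intro h
    have h1 := congrArg (Int.castRingHom ℚ) h
    rw [RingHom.map_det, RingHom.mapMatrix_apply, hBV, Matrix.det_smul, map_zero] at h1
    exact mul_ne_zero (pow_ne_zero _ hN0) hV h1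
  · ext i j
    rcases eq_or_ne i j with rfl | hij
    · simp
    rw [Matrix.diagonal_apply_ne _ hij]
    have h1 : (((Bmᵀ * M * Bm) i j : ℤ) : ℚ) = (((Bmᵀ * M * Bm).map (Int.castRingHom ℚ)) i j) := rfl
    have h2 : (Vᵀ * Mq * V) i j = φ (b i) (b j) := by
      rw [hφ, Matrix.mul_assoc]; rfl
    have h3 : (((Bmᵀ * M * Bm) i j : ℤ) : ℚ) = 0 := by
      rw [h1, Matrix.map_mul, Matrix.map_mul, Matrix.transpose_map, hBV]
      have : M.map (Int.castRingHom ℚ) = Mq := rfl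
      rw [this, Matrix.transpose_smul, Matrix.smul_mul, Matrix.smul_mul, Matrix.mul_smul,
        Matrix.smul_apply, Matrix.smul_apply, h2, hb i j hij]
      simp
    exact_mod_cast h3

/-- Let `(K, φ)` be a nonsingular symmetric bilinear form over `ℤ`, given by a
symmetric integer matrix `M` with `det M = ±1`, and let `v` be a characteristic
element, i.e. `φ(u,u) ≡ φ(u,v) (mod 2)` for all `u`. Then
`signature(K, φ) ≡ φ(v,v) (mod 8)`, where the signature is computed from any real
diagonalization `Pᵀ·M·P = diag d` as the number of positive entries of `d` minus
the number of negative entries. -/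
theorem stmt_16 (n : ℕ) (M : Matrix (Fin n) (Fin n) ℤ) (hsym : Mᵀ = M)
    (hdet : M.det = 1 ∨ M.det = -1)
    (v : Fin n → ℤ)
    (hv : ∀ u : Fin n → ℤ, u ⬝ᵥ M.mulVec u ≡ u ⬝ᵥ M.mulVec v [ZMOD 2])
    (P : Matrix (Fin n) (Fin n) ℝ) (hP : IsUnit P.det) (d : Fin n → ℝ)
    (hdiag : Pᵀ * M.map (Int.cast : ℤ → ℝ) * P = Matrix.diagonal d) :
    (((Finset.univ.filter (fun i : Fin n => 0 < d i)).card : ℤ)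
        - ((Finset.univ.filter (fun i : Fin n => d i < 0)).card : ℤ))
      ≡ v ⬝ᵥ M.mulVec v [ZMOD 8] := by
  obtain ⟨B, a, hB, hdB⟩ := vdb_exists M hsym
  have hM0 : M.det ≠ 0 := by rcases hdet with h | h <;> rw [h] <;> norm_num
  have ha : ∀ i, a i ≠ 0 := by
    have h1 := congrArg Matrix.det hdB
    rw [Matrix.det_mul, Matrix.det_mul, Matrix.det_transpose, Matrix.det_diagonal] at h1
    have h2 : ∏ i, a i ≠ 0 := h1 ▸ mul_ne_zero (mul_ne_zero hB hM0) hB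
    exact fun i => Finset.prod_ne_zero_iff.mp h2 i (Finset.mem_univ i)
  have key := vdb_lattice M B hsym hdet v hv a ha hdB
  have s1 := vdb_sig _ P hP d hdiag
  have s2 := vdb_sig (M.map (Int.cast : ℤ → ℝ)) (B.map (Int.castRingHom ℝ)) (by
    have : ((B.det : ℤ) : ℝ) ≠ 0 := by exact_mod_cast hB
    rw [isUnit_iff_ne_zero]
    have h1 := RingHom.map_det (Int.castRingHom ℝ) B
    rw [RingHom.mapMatrix_apply] at h1
    rw [← h1]
    exact this) (fun i => (a i : ℝ)) (by
    have := congrArg (fun A : Matrix (Fin n) (Fin n) ℤ => A.map (Int.castRingHom ℝ)) hdB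
    simp only [Matrix.map_mul] at this
    rw [Matrix.diagonal_map (by simp)] at this
    exact this)
  have hsum : ∑ i, (a i).sign = ((Finset.univ.filter (fun i : Fin n => 0 < d i)).card : ℤ)
        - ((Finset.univ.filter (fun i : Fin n => d i < 0)).card : ℤ) := by
    rw [← s1.1, ← s1.2, s2.1, s2.2, Finset.card_filter, Finset.card_filter]
    push_cast
    rw [← Finset.sum_sub_distrib]
    refine Finset.sum_congr rfl fun i _ => ?_
    rcases lt_trichotomy (a i) 0 with h | h | h
    · have h' : ¬ (0 < a i) := by omega
      simp [Int.sign_eq_neg_one_of_neg h, h, h']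
    · simp [h]
    · have h' : ¬ (a i < 0) := by omega
      simp [Int.sign_eq_one_of_pos h, h, h']
  rw [← hsum]
  exact key
end
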